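/- The Alternation-Free One-Step Graded μ-Calculus is subsumed by WMTL over finitely-branching trees: every OSAFGμC sentence has a WMTL sentence satisfied by exactly the same finitely-branching Kripke trees. -/

import Mathlib

/-! ## Trees over ℕ* -/

abbrev Node : Type := List ℕ

/-- `T` is a tree with root `r`: `r ∈ T`, every node extends `r`, and `T` is
prefix-closed above `r`. -/
def IsTreeRooted (T : Set Node) (r : Node) : Prop :=
  r ∈ T ∧ (∀ τ ∈ T, r <+: τ) ∧
    ∀ σ σ' : List ℕ, r ++ σ ∈ T → σ' <+: σ → r ++ σ' ∈ T

/-- `T ⊆ ℕ*` is a tree. -/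
def IsTree (T : Set Node) : Prop := ∃ r : Node, IsTreeRooted T r

/-- `τ'` is a child of `τ` in `T`. -/
def childIn (T : Set Node) (τ τ' : Node) : Prop := τ' ∈ T ∧ ∃ n : ℕ, τ' = τ ++ [n]

/-- every node of `T` has a child in `T`. -/
def NonBlocking (T : Set Node) : Prop := ∀ τ ∈ T, ∃ n : ℕ, τ ++ [n] ∈ T

/-- every node of `T` has finitely many children in `T`. -/
def FinBranching (T : Set Node) : Prop := ∀ τ ∈ T, {τ' : Node | childIn T τ τ'}.Finite

/-- `S` is a subtree of `T`. -/
def IsSubtree (T S : Set Node) : Prop := S ⊆ T ∧ IsTree S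

/-- `P` is a path of `T`: a subtree totally ordered by the child relation
(each node has at most one child in `P`). -/
def IsPathOf (T P : Set Node) : Prop :=
  IsSubtree T P ∧ ∀ τ ∈ P, ∀ n m : ℕ, τ ++ [n] ∈ P → τ ++ [m] ∈ P → n = m

/-- `T` is a chain: a tree in which each node has at most one child. -/
def IsChainTree (T : Set Node) : Prop :=
  IsTree T ∧ ∀ τ ∈ T, ∀ n m : ℕ, τ ++ [n] ∈ T → τ ++ [m] ∈ T → n = m

/-- `T` is dense: it contains a subtree every node of which has a descendant
in the subtree with at least two distinct children in the subtree. -/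
def DenseTree (T : Set Node) : Prop :=
  ∃ S : Set Node, IsSubtree T S ∧ ∀ τ ∈ S, ∃ τ' ∈ S, τ <+: τ' ∧
    ∃ n m : ℕ, n ≠ m ∧ τ' ++ [n] ∈ S ∧ τ' ++ [m] ∈ S

/-- A Kripke tree over `AP`: a non-blocking tree together with a labelling. -/
structure KripkeTree (AP : Type) where
  T : Set Node
  root : Node
  rooted : IsTreeRooted T root
  nonblocking : NonBlocking T
  Lab : Node → Set AP

/-! ## MSOL syntax -/

inductive MSOL (AP : Type) : Type
  | atom : AP → ℕ → MSOL AP          -- P_a(x)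
  | le   : ℕ → ℕ → MSOL AP           -- x ≤ y
  | mem  : ℕ → ℕ → MSOL AP           -- x ∈ X
  | not  : MSOL AP → MSOL AP
  | and  : MSOL AP → MSOL AP → MSOL AP
  | exFO : ℕ → MSOL AP → MSOL AP     -- ∃x. φ
  | exSO : ℕ → MSOL AP → MSOL AP     -- ∃X. φ

namespace MSOL

def freeFO {AP : Type} : MSOL AP → Set ℕ
  | atom _ x => {x}
  | le x y => {x, y}
  | mem x _ => {x}
  | not φ => φ.freeFO
  | and φ ψ => φ.freeFO ∪ ψ.freeFO
  | exFO x φ => φ.freeFO \ {x}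
  | exSO _ φ => φ.freeFO

def freeSO {AP : Type} : MSOL AP → Set ℕ
  | atom _ _ => ∅
  | le _ _ => ∅
  | mem _ X => {X}
  | not φ => φ.freeSO
  | and φ ψ => φ.freeSO ∪ ψ.freeSO
  | exFO _ φ => φ.freeSO
  | exSO X φ => φ.freeSO \ {X}

/-- A sentence is a formula with no free variables. -/
def IsSentence {AP : Type} (φ : MSOL AP) : Prop := φ.freeFO = ∅ ∧ φ.freeSO = ∅

/-- The first-order fragment: no second-order variables. -/
def IsFO {AP : Type} : MSOL AP → Prop
  | atom _ _ => True
  | le _ _ => True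
  | mem _ _ => False
  | not φ => φ.IsFO
  | and φ ψ => φ.IsFO ∧ ψ.IsFO
  | exFO _ φ => φ.IsFO
  | exSO _ _ => False

end MSOL

/-! ## MSOL semantics, parametrized by the range of second-order quantifiers -/

/-- A second-order domain: for each tree, the collection of sets that
second-order quantifiers range over. -/
abbrev SODom : Type := Set Node → Set (Set Node)

def Sat {AP : Type} (D : SODom) (K : KripkeTree AP) :
    (ℕ → Node) → (ℕ → Set Node) → MSOL AP → Prop
  | V1, _,  .atom a x => V1 x ∈ K.T ∧ a ∈ K.Lab (V1 x)
  | V1, _,  .le x y => V1 x ∈ K.T ∧ V1 y ∈ K.T ∧ V1 x <+: V1 y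
  | V1, V2, .mem x X => V1 x ∈ V2 X
  | V1, V2, .not φ => ¬ Sat D K V1 V2 φ
  | V1, V2, .and φ ψ => Sat D K V1 V2 φ ∧ Sat D K V1 V2 ψ
  | V1, V2, .exFO x φ => ∃ τ ∈ K.T, Sat D K (Function.update V1 x τ) V2 φ
  | V1, V2, .exSO X φ => ∃ S ∈ D K.T, Sat D K V1 (Function.update V2 X S) φ

/-- A logic: a syntactic fragment of MSOL together with a second-order domain. -/
structure MLogic (AP : Type) where
  syn : MSOL AP → Prop
  dom : SODom

namespace MLogic

/-- A Kripke tree satisfies a sentence. -/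
def KSat {AP : Type} (L : MLogic AP) (K : KripkeTree AP) (φ : MSOL AP) : Prop :=
  ∃ V1 V2, Sat L.dom K V1 V2 φ

/-- `L ≤ L'` over the class `M`. -/
def Leq {AP : Type} (M : Set (KripkeTree AP)) (L L' : MLogic AP) : Prop :=
  ∀ φ : MSOL AP, φ.IsSentence → L.syn φ →
    ∃ φ' : MSOL AP, φ'.IsSentence ∧ L'.syn φ' ∧
      ∀ K ∈ M, (L.KSat K φ ↔ L'.KSat K φ')

/-- `L < L'` over the class `M`. -/
def Lt {AP : Type} (M : Set (KripkeTree AP)) (L L' : MLogic AP) : Prop :=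
  Leq M L L' ∧ ¬ Leq M L' L

/-- `L ≡ L'` over the class `M`. -/
def EquivExp {AP : Type} (M : Set (KripkeTree AP)) (L L' : MLogic AP) : Prop :=
  Leq M L L' ∧ Leq M L' L

/-- `L` and `L'` are expressively incomparable over the class `M`. -/
def Incomp {AP : Type} (M : Set (KripkeTree AP)) (L L' : MLogic AP) : Prop :=
  ¬ Leq M L L' ∧ ¬ Leq M L' L

end MLogic

/-! ## The concrete logics -/

def MSOdom : SODom := fun T => {S | S ⊆ T}
def MTLdom : SODom := fun T => {S | S ⊆ T ∧ IsTree S}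
def MPLdom : SODom := fun T => {S | IsPathOf T S}
def weakDom (D : SODom) : SODom := fun T => {S | S ∈ D T ∧ S.Finite}
def coweakDom (D : SODom) : SODom := fun T => {S | S ∈ D T ∧ S.Infinite}

def MSO (AP : Type) : MLogic AP := ⟨fun _ => True, MSOdom⟩
def MTL (AP : Type) : MLogic AP := ⟨fun _ => True, MTLdom⟩
def MPL (AP : Type) : MLogic AP := ⟨fun _ => True, MPLdom⟩
def WMSO (AP : Type) : MLogic AP := ⟨fun _ => True, weakDom MSOdom⟩
def WMTL (AP : Type) : MLogic AP := ⟨fun _ => True, weakDom MTLdom⟩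
def WMPL (AP : Type) : MLogic AP := ⟨fun _ => True, weakDom MPLdom⟩
def CoWMSO (AP : Type) : MLogic AP := ⟨fun _ => True, coweakDom MSOdom⟩
def CoWMTL (AP : Type) : MLogic AP := ⟨fun _ => True, coweakDom MTLdom⟩
def CoWMPL (AP : Type) : MLogic AP := ⟨fun _ => True, coweakDom MPLdom⟩
def FOL (AP : Type) : MLogic AP := ⟨MSOL.IsFO, MSOdom⟩

/-! ## Classes of Kripke trees -/

def allKT (AP : Type) : Set (KripkeTree AP) := Set.univ
def finBrKT (AP : Type) : Set (KripkeTree AP) := {K | FinBranching K.T}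
/-- Kripke trees whose underlying tree is an infinite chain
(every node has exactly one child). -/
def chainKT (AP : Type) : Set (KripkeTree AP) :=
  {K | ∀ τ ∈ K.T, ∃! τ' : Node, childIn K.T τ τ'}

/-! ## Graded μ-calculus -/

inductive GMC (AP : Type) : Type
  | ff  : GMC AP
  | tt  : GMC AP
  | atom : AP → GMC AP
  | not : GMC AP → GMC AP
  | and : GMC AP → GMC AP → GMC AP
  | or  : GMC AP → GMC AP → GMC AP
  | var : ℕ → GMC AP
  | dia : ℕ → GMC AP → GMC AP     -- ◇_{≥k} φ
  | box : ℕ → GMC AP → GMC AP     -- □_{<k} φ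
  | mu  : ℕ → GMC AP → GMC AP
  | nu  : ℕ → GMC AP → GMC AP

namespace GMC

/-- The set of children of `τ` in `T`. -/
def childrenIn (T : Set Node) (τ : Node) : Set Node := {τ' : Node | childIn T τ τ'}

/-- `S` contains at least `k` elements. -/
def atLeast (k : ℕ) (S : Set Node) : Prop :=
  ∃ F : Finset Node, F.card = k ∧ ↑F ⊆ S

/-- Denotation of a graded μ-calculus formula in a Kripke tree, under an
assignment of the fixpoint variables to sets of nodes. -/
def denot {AP : Type} (K : KripkeTree AP) : GMC AP → (ℕ → Set Node) → Set Node
  | .ff, _ => ∅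
  | .tt, _ => K.T
  | .atom a, _ => {τ ∈ K.T | a ∈ K.Lab τ}
  | .not φ, V => K.T \ denot K φ V
  | .and φ ψ, V => denot K φ V ∩ denot K ψ V
  | .or φ ψ, V => denot K φ V ∪ denot K ψ V
  | .var X, V => V X
  | .dia k φ, V => {τ ∈ K.T | atLeast k (childrenIn K.T τ ∩ denot K φ V)}
  | .box k φ, V => {τ ∈ K.T | ¬ atLeast k (childrenIn K.T τ \ denot K φ V)}
  | .mu X φ, V => ⋂₀ {W : Set Node | W ⊆ K.T ∧ denot K φ (Function.update V X W) ⊆ W}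
  | .nu X φ, V => ⋃₀ {W : Set Node | W ⊆ K.T ∧ W ⊆ denot K φ (Function.update V X W)}

/-- Free fixpoint variables. -/
def free {AP : Type} : GMC AP → Set ℕ
  | .ff => ∅
  | .tt => ∅
  | .atom _ => ∅
  | .not φ => φ.free
  | .and φ ψ => φ.free ∪ ψ.free
  | .or φ ψ => φ.free ∪ ψ.free
  | .var X => {X}
  | .dia _ φ => φ.free
  | .box _ φ => φ.free
  | .mu X φ => φ.free \ {X}
  | .nu X φ => φ.free \ {X}

/-- Every free occurrence of `X` lies under an even (`b = true`) resp. odd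
(`b = false`) number of negations. -/
def polOK {AP : Type} (X : ℕ) : Bool → GMC AP → Prop
  | _, .ff => True
  | _, .tt => True
  | _, .atom _ => True
  | b, .not φ => polOK X (!b) φ
  | b, .and φ ψ => polOK X b φ ∧ polOK X b ψ
  | b, .or φ ψ => polOK X b φ ∧ polOK X b ψ
  | b, .var Y => Y = X → b = true
  | b, .dia _ φ => polOK X b φ
  | b, .box _ φ => polOK X b φ
  | b, .mu Y φ => Y = X ∨ polOK X b φ
  | b, .nu Y φ => Y = X ∨ polOK X b φ

/-- Every bound variable occurs only positively in the scope of its binder. -/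
def boundPos {AP : Type} : GMC AP → Prop
  | .ff => True
  | .tt => True
  | .atom _ => True
  | .not φ => φ.boundPos
  | .and φ ψ => φ.boundPos ∧ ψ.boundPos
  | .or φ ψ => φ.boundPos ∧ ψ.boundPos
  | .var _ => True
  | .dia _ φ => φ.boundPos
  | .box _ φ => φ.boundPos
  | .mu X φ => φ.boundPos ∧ polOK X true φ
  | .nu X φ => φ.boundPos ∧ polOK X true φ

/-- Every occurrence of every variable (free or bound) is positive. -/
def AllPos {AP : Type} (θ : GMC AP) : Prop :=
  θ.boundPos ∧ ∀ X : ℕ, polOK X true θ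

end GMC

mutual
  /-- Base formulas `Φ[Z,O]` of the One-Step Graded μ-Calculus. -/
  inductive IsBase {AP : Type} : Set ℕ → Set ℕ → GMC AP → Prop
    | ff   : ∀ {Z O : Set ℕ}, IsBase Z O .ff
    | tt   : ∀ {Z O : Set ℕ}, IsBase Z O .tt
    | atom : ∀ {Z O : Set ℕ} (a : AP), IsBase Z O (.atom a)
    | not  : ∀ {Z O : Set ℕ} {φ : GMC AP}, IsBase Z O φ → IsBase Z O (.not φ)
    | and  : ∀ {Z O : Set ℕ} {φ ψ : GMC AP},
        IsBase Z O φ → IsBase Z O ψ → IsBase Z O (.and φ ψ)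
    | or   : ∀ {Z O : Set ℕ} {φ ψ : GMC AP},
        IsBase Z O φ → IsBase Z O ψ → IsBase Z O (.or φ ψ)
    | dia  : ∀ {Z O : Set ℕ} {φ : GMC AP} (k : ℕ),
        IsBase O ∅ φ → IsBase Z O (.dia k φ)
    | box  : ∀ {Z O : Set ℕ} {φ : GMC AP} (k : ℕ),
        IsBase O ∅ φ → IsBase Z O (.box k φ)
    | var  : ∀ {Z O : Set ℕ} {X : ℕ}, X ∈ Z → IsBase Z O (.var X)
    | fix  : ∀ {Z O : Set ℕ} {θ : GMC AP}, IsFix ∅ ∅ θ → IsBase Z O θ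
  /-- Fixpoint formulas `Θ[Z,O]` of the One-Step Graded μ-Calculus. -/
  inductive IsFix {AP : Type} : Set ℕ → Set ℕ → GMC AP → Prop
    | mu : ∀ {Z O : Set ℕ} {X : ℕ} {θ : GMC AP},
        IsFix (Z ∪ {X}) (O ∪ {X}) θ → IsFix Z O (.mu X θ)
    | nu : ∀ {Z O : Set ℕ} {X : ℕ} {θ : GMC AP},
        IsFix (Z ∪ {X}) (O ∪ {X}) θ → IsFix Z O (.nu X θ)
    | base : ∀ {Z O : Set ℕ} {φ : GMC AP}, IsBase Z O φ → IsFix Z O φ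
end

/-- A Kripke tree satisfies a μ-calculus sentence iff its root belongs to its
denotation under the empty assignment. -/
def GKSat {AP : Type} (K : KripkeTree AP) (θ : GMC AP) : Prop :=
  K.root ∈ GMC.denot K θ (fun _ => ∅)

namespace GMC

/-- `X` does not occur free in any ν-subformula. -/
def noFreeInNu {AP : Type} (X : ℕ) : GMC AP → Prop
  | .ff => True
  | .tt => True
  | .atom _ => True
  | .var _ => True
  | .not φ => noFreeInNu X φ
  | .and φ ψ => noFreeInNu X φ ∧ noFreeInNu X ψ
  | .or φ ψ => noFreeInNu X φ ∧ noFreeInNu X ψ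
  | .dia _ φ => noFreeInNu X φ
  | .box _ φ => noFreeInNu X φ
  | .mu Y φ => Y = X ∨ noFreeInNu X φ
  | .nu Y φ => X ∉ (GMC.nu Y φ).free

/-- `X` does not occur free in any μ-subformula. -/
def noFreeInMu {AP : Type} (X : ℕ) : GMC AP → Prop
  | .ff => True
  | .tt => True
  | .atom _ => True
  | .var _ => True
  | .not φ => noFreeInMu X φ
  | .and φ ψ => noFreeInMu X φ ∧ noFreeInMu X ψ
  | .or φ ψ => noFreeInMu X φ ∧ noFreeInMu X ψ
  | .dia _ φ => noFreeInMu X φ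
  | .box _ φ => noFreeInMu X φ
  | .nu Y φ => Y = X ∨ noFreeInMu X φ
  | .mu Y φ => X ∉ (GMC.mu Y φ).free

/-- Alternation-freeness: no μ-bound variable occurs free in a ν-subformula
of its scope and vice versa. -/
def AltFree {AP : Type} : GMC AP → Prop
  | .ff => True
  | .tt => True
  | .atom _ => True
  | .var _ => True
  | .not φ => AltFree φ
  | .and φ ψ => AltFree φ ∧ AltFree ψ
  | .or φ ψ => AltFree φ ∧ AltFree ψ
  | .dia _ φ => AltFree φ
  | .box _ φ => AltFree φ
  | .mu X φ => AltFree φ ∧ noFreeInNu X φ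
  | .nu X φ => AltFree φ ∧ noFreeInMu X φ

end GMC

/-! ## Helper material for the proof -/

namespace OS

variable {AP : Type}

abbrev WD : SODom := weakDom MTLdom

theorem rooted_iff (S : Set Node) (r : Node) :
    IsTreeRooted S r ↔ r ∈ S ∧ (∀ τ ∈ S, r <+: τ) ∧ ∀ τ ∈ S, ∀ v, r <+: v → v <+: τ → v ∈ S := by
  unfold IsTreeRooted
  constructor
  · rintro ⟨h1, h2, h3⟩
    refine ⟨h1, h2, ?_⟩
    rintro τ hτ v ⟨s, rfl⟩ ⟨t, rfl⟩
    exact h3 (s ++ t) s (by simpa using hτ) ⟨t, rfl⟩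
  · rintro ⟨h1, h2, h3⟩
    refine ⟨h1, h2, ?_⟩
    rintro σ σ' hσ ⟨t, rfl⟩
    exact h3 _ hσ _ ⟨σ', rfl⟩ ⟨t, by simp⟩

theorem fin_trunc (K : KripkeTree AP) (hK : FinBranching K.T) (N : ℕ) :
    {w ∈ K.T | w.length ≤ N}.Finite := by
  have hr := (rooted_iff _ _).1 K.rooted
  induction N with
  | zero =>
    refine (Set.finite_singleton ([] : Node)).subset ?_
    rintro w ⟨-, hw⟩
    simpa using hw
  | succ N ih =>
    have : {w ∈ K.T | w.length ≤ N + 1} ⊆ {K.root} ∪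
        ⋃ v ∈ {w ∈ K.T | w.length ≤ N}, {τ' : Node | childIn K.T v τ'} := by
      rintro w ⟨hw, hl⟩
      by_cases hwr : w = K.root
      · left; exact hwr
      right
      obtain ⟨t, rfl⟩ := hr.2.1 w hw
      rcases List.eq_nil_or_concat t with rfl | ⟨u, n, rfl⟩
      · simp at hwr
      · simp only [Set.mem_iUnion]
        refine ⟨K.root ++ u, ⟨hr.2.2 _ hw _ ⟨u, rfl⟩ ⟨[n], by simp⟩, ?_⟩, hw, n, by simp⟩
        simp at hl ⊢; omega
    refine Set.Finite.subset ?_ this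
    refine (Set.finite_singleton _).union (ih.biUnion ?_)
    intro v hv
    exact hK v hv.1

theorem fin_bound (S : Set Node) (hS : S.Finite) : ∃ N : ℕ, ∀ w ∈ S, w.length ≤ N := by
  obtain ⟨N, hN⟩ := (hS.image List.length).bddAbove
  exact ⟨N, fun w hw => hN ⟨w, hw, rfl⟩⟩

/-- the locality and monotonicity of a one-step operator -/
structure OneStep (T : Set Node) (f : Set Node → Set Node) : Prop where
  sub : ∀ W, W ⊆ T → f W ⊆ T
  mono : ∀ W W', W ⊆ T → W' ⊆ T → W ⊆ W' → f W ⊆ f W'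
  loc : ∀ W W' σ, W ⊆ T → W' ⊆ T → σ ∈ T → (σ ∈ W ↔ σ ∈ W') →
    (∀ c ∈ GMC.childrenIn T σ, (c ∈ W ↔ c ∈ W')) → (σ ∈ f W ↔ σ ∈ f W')

def gf (T : Set Node) (f : Set Node → Set Node) : Set Node := ⋃₀ {W | W ⊆ T ∧ W ⊆ f W}
def lf (T : Set Node) (f : Set Node → Set Node) : Set Node := ⋂₀ {W | W ⊆ T ∧ f W ⊆ W}

def GG (T : Set Node) (f : Set Node → Set Node) : Set Node :=
  {x ∈ T | ∀ S ∈ WD T, ∃ W ∈ WD T, x ∈ W ∧ ∀ w ∈ T, w ∈ W → w ∈ S → w ∈ f W}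

theorem gf_eq (K : KripkeTree AP) (hK : FinBranching K.T) (f : Set Node → Set Node)
    (hf : OneStep K.T f) : gf K.T f = GG K.T f := by
  have hr := (rooted_iff _ _).1 K.rooted
  apply Set.Subset.antisymm
  · rintro x ⟨W0, ⟨hWT, hWf⟩, hx⟩
    refine ⟨hWT hx, ?_⟩
    rintro S ⟨⟨hST, -⟩, hSf⟩
    obtain ⟨N, hN⟩ := fin_bound (insert x S) (hSf.insert x)
    let W : Set Node := {w ∈ K.T | w.length ≤ N + 1 ∧ x <+: w ∧
      ∀ v, x <+: v → v <+: w → v ∈ W0}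
    have hxW : x ∈ W := by
      refine ⟨hWT hx, (hN x (by simp)).trans (by omega), List.prefix_rfl, ?_⟩
      intro v h1 h2
      have : v = x := h2.eq_of_length_le h1.length_le
      rwa [this]
    have hWsub : W ⊆ K.T := fun w hw => hw.1
    refine ⟨W, ⟨⟨hWsub, x, ?_⟩, (fin_trunc K hK (N+1)).subset fun w hw => ⟨hw.1, hw.2.1⟩⟩, hxW, ?_⟩
    · rw [rooted_iff]
      refine ⟨hxW, fun τ h => h.2.2.1, ?_⟩
      rintro τ ⟨h1, h2, h3, h4⟩ v hv1 hv2
      exact ⟨hr.2.2 τ h1 v ((hr.2.1 x (hWT hx)).trans hv1) hv2,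
        hv2.length_le.trans h2, hv1, fun u hu1 hu2 => h4 u hu1 (hu2.trans hv2)⟩
    · intro w hwT hwW hwS
      have hw0 : w ∈ W0 := hwW.2.2.2 w hwW.2.2.1 List.prefix_rfl
      refine (hf.loc W0 W w hWT hWsub hwT (by simp [hw0, hwW]) ?_).1 (hWf hw0)
      rintro c ⟨hcT, n, rfl⟩
      constructor
      · intro hc
        refine ⟨hcT, ?_, hwW.2.2.1.trans ⟨[n], rfl⟩, ?_⟩
        · have := hN w (by simp [hwS])
          simp; omega
        · intro v hv1 hv2
          rcases List.prefix_concat_iff.1 hv2 with h | h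
          · rw [h]; exact hc
          · exact hwW.2.2.2 v hv1 h
      · intro hc
        exact hc.2.2.2 _ hc.2.2.1 List.prefix_rfl
  · apply Set.subset_sUnion_of_mem
    refine ⟨fun x hx => hx.1, ?_⟩
    intro σ hσ
    have hch : ∀ ρ : Node, ∃ S : Set Node, S.Finite ∧ (ρ ∈ K.T → ρ ∉ GG K.T f →
        ¬ ∃ W ∈ WD K.T, ρ ∈ W ∧ ∀ w ∈ K.T, w ∈ W → w ∈ S → w ∈ f W) := by
      intro ρ
      by_cases h : ρ ∈ K.T ∧ ρ ∉ GG K.T f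
      · have h2 : ¬ ∀ S ∈ WD K.T, ∃ W ∈ WD K.T, ρ ∈ W ∧ ∀ w ∈ K.T, w ∈ W → w ∈ S → w ∈ f W :=
          fun h' => h.2 ⟨h.1, h'⟩
        push Not at h2
        obtain ⟨S, hS, h3⟩ := h2
        refine ⟨S, hS.2, fun _ _ => ?_⟩
        push Not
        exact h3
      · exact ⟨∅, Set.finite_empty, fun h1 h2 => absurd ⟨h1, h2⟩ h⟩
    choose SS hSf hSS using hch
    have hNf : (insert σ (GMC.childrenIn K.T σ)).Finite := (hK σ hσ.1).insert σ
    obtain ⟨N, hN⟩ := fin_bound _ (hNf.biUnion (fun ρ _ => hSf ρ))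
    have hS : {w ∈ K.T | w.length ≤ max N σ.length ∧ σ <+: w} ∈ WD K.T := by
      refine ⟨⟨fun w hw => hw.1, σ, ?_⟩, (fin_trunc K hK (max N σ.length)).subset
        fun w hw => ⟨hw.1, hw.2.1⟩⟩
      rw [rooted_iff]
      refine ⟨⟨hσ.1, le_max_right _ _, List.prefix_rfl⟩, fun τ h => h.2.2, ?_⟩
      rintro τ ⟨h1, h2, h3⟩ v hv1 hv2
      exact ⟨hr.2.2 τ h1 v ((hr.2.1 σ hσ.1).trans hv1) hv2, hv2.length_le.trans h2, hv1⟩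
    obtain ⟨W, ⟨⟨hWT, hWtree⟩, hWfin⟩, hσW, hW⟩ := hσ.2 _ hS
    have key : ∀ ρ ∈ insert σ (GMC.childrenIn K.T σ), ρ ∈ W → ρ ∈ GG K.T f := by
      intro ρ hρ hρW
      by_contra hG
      have hσρ : σ <+: ρ := by
        rcases hρ with rfl | ⟨_, n, rfl⟩
        · exact List.prefix_rfl
        · exact ⟨[n], rfl⟩
      apply hSS ρ (hWT hρW) hG
      have hsub : {w ∈ W | ρ <+: w} ⊆ K.T := fun w hw => hWT hw.1
      refine ⟨{w ∈ W | ρ <+: w}, ⟨⟨hsub, ρ, ?_⟩,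
        hWfin.subset fun w hw => hw.1⟩, ⟨hρW, List.prefix_rfl⟩, ?_⟩
      · obtain ⟨q, hq⟩ := hWtree
        rw [rooted_iff] at hq ⊢
        refine ⟨⟨hρW, List.prefix_rfl⟩, fun τ h => h.2, ?_⟩
        rintro τ ⟨h1, h2⟩ v hv1 hv2
        exact ⟨hq.2.2 τ h1 v ((hq.2.1 ρ hρW).trans hv1) hv2, hv1⟩
      · rintro w hwT ⟨hwW, hρw⟩ hwS
        have hwN : w.length ≤ N := hN w (by
          simp only [Set.mem_iUnion]; exact ⟨ρ, hρ, hwS⟩)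
        have hwf := hW w hwT hwW ⟨hwT, hwN.trans (le_max_left _ _), hσρ.trans hρw⟩
        refine (hf.loc W _ w hWT hsub hwT ?_ ?_).1 hwf
        · simp [hρw]
        · rintro c ⟨hcT, n, rfl⟩
          have : ρ <+: w ++ [n] := hρw.trans ⟨[n], rfl⟩
          simp [this]
    have hσf := hW σ hσ.1 hσW ⟨hσ.1, le_max_right _ _, List.prefix_rfl⟩
    have hGT : GG K.T f ⊆ K.T := fun x hx => hx.1
    have h1 : σ ∈ f (W ∩ GG K.T f) := by
      refine (hf.loc W _ σ hWT (fun w hw => hWT hw.1) hσ.1 ?_ ?_).1 hσf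
      · simp [hσ]
      · intro c hc
        exact ⟨fun h => ⟨h, key c (Or.inr hc) h⟩, fun h => h.1⟩
    exact hf.mono _ _ (fun w hw => hWT hw.1) hGT (fun w hw => hw.2) h1

def dual (T : Set Node) (f : Set Node → Set Node) : Set Node → Set Node := fun W => T \ f (T \ W)

theorem dual_oneStep {T : Set Node} {f : Set Node → Set Node} (hf : OneStep T f) :
    OneStep T (dual T f) where
  sub := fun W _ => Set.sdiff_subset
  mono := by
    intro W W' h h' hs
    apply Set.sdiff_subset_sdiff_right
    exact hf.mono _ _ Set.sdiff_subset Set.sdiff_subset (Set.sdiff_subset_sdiff_right hs)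
  loc := by
    intro W W' σ h h' hσ h1 h2
    have := hf.loc (T \ W) (T \ W') σ Set.sdiff_subset Set.sdiff_subset hσ
      (by simp [h1]) (fun c hc => by simp [h2 c hc])
    simp only [dual, Set.mem_sdiff, this]

theorem lf_eq {T : Set Node} {f : Set Node → Set Node} (hf : OneStep T f) :
    lf T f = T \ gf T (dual T f) := by
  have h0 : lf T f ⊆ T := Set.sInter_subset_of_mem ⟨subset_rfl, hf.sub T subset_rfl⟩
  apply Set.Subset.antisymm
  · intro x hx
    refine ⟨h0 hx, ?_⟩
    rintro ⟨W, ⟨hW1, hW2⟩, hxW⟩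
    have : x ∈ T \ W := hx _ ⟨Set.sdiff_subset, fun y hy =>
      ⟨hf.sub _ Set.sdiff_subset hy, fun hyW => (hW2 hyW).2 hy⟩⟩
    exact this.2 hxW
  · rintro x ⟨hxT, hx⟩ W ⟨hW1, hW2⟩
    by_contra hxW
    apply hx
    refine ⟨T \ W, ⟨Set.sdiff_subset, ?_⟩, hxT, hxW⟩
    rintro y ⟨hyT, hyW⟩
    refine ⟨hyT, fun h => hyW (hW2 ?_)⟩
    have : T \ (T \ W) = W := by simp [hW1]
    rwa [this] at h

/-! ### diagonal laws -/

theorem lf_diag (T : Set Node) (g : Set Node → Set Node → Set Node)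
    (hsub : ∀ W U, W ⊆ T → U ⊆ T → g W U ⊆ T)
    (hm : ∀ W W' U U', W ⊆ T → W' ⊆ T → U ⊆ T → U' ⊆ T → W ⊆ W' → U ⊆ U' → g W U ⊆ g W' U') :
    lf T (fun W => lf T (g W)) = lf T (fun U => g U U) := by
  apply Set.Subset.antisymm
  · rintro x hx W ⟨hW1, hW2⟩
    exact hx W ⟨hW1, Set.sInter_subset_of_mem ⟨hW1, hW2⟩⟩
  · rintro x hx W ⟨hW1, hW2⟩
    have hLT : lf T (g W) ⊆ T := hW2.trans hW1
    have hpre : g W (lf T (g W)) ⊆ lf T (g W) := by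
      rintro y hy U ⟨hU1, hU2⟩
      exact hU2 (hm W W _ U hW1 hW1 hLT hU1 subset_rfl (Set.sInter_subset_of_mem ⟨hU1, hU2⟩) hy)
    exact hW2 (hx _ ⟨hLT, (hm _ W _ _ hLT hW1 hLT hLT hW2 subset_rfl).trans hpre⟩)

theorem gf_diag (T : Set Node) (g : Set Node → Set Node → Set Node)
    (hsub : ∀ W U, W ⊆ T → U ⊆ T → g W U ⊆ T)
    (hm : ∀ W W' U U', W ⊆ T → W' ⊆ T → U ⊆ T → U' ⊆ T → W ⊆ W' → U ⊆ U' → g W U ⊆ g W' U') :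
    gf T (fun W => gf T (g W)) = gf T (fun U => g U U) := by
  have hGT : ∀ W, gf T (g W) ⊆ T := fun W => Set.sUnion_subset fun U hU => hU.1
  apply Set.Subset.antisymm
  · rintro x ⟨W, ⟨hW1, hW2⟩, hx⟩
    have hpost : gf T (g W) ⊆ g W (gf T (g W)) := by
      rintro y ⟨U, ⟨hU1, hU2⟩, hy⟩
      exact hm W W U _ hW1 hW1 hU1 (hGT W) subset_rfl (Set.subset_sUnion_of_mem ⟨hU1, hU2⟩) (hU2 hy)
    exact ⟨_, ⟨hGT W, hpost.trans (hm _ _ _ _ hW1 (hGT W) (hGT W) (hGT W) hW2 subset_rfl)⟩, hW2 hx⟩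
  · rintro x ⟨W, ⟨hW1, hW2⟩, hx⟩
    exact ⟨W, ⟨hW1, Set.subset_sUnion_of_mem ⟨hW1, hW2⟩⟩, hx⟩

/-! ### generic facts on denotations -/

theorem atLeast_mono {k : ℕ} {A B : Set Node} (h : A ⊆ B) :
    GMC.atLeast k A → GMC.atLeast k B := by
  rintro ⟨F, h1, h2⟩
  exact ⟨F, h1, h2.trans h⟩

theorem denot_free (K : KripkeTree AP) (φ : GMC AP) :
    ∀ V V' : ℕ → Set Node, (∀ X ∈ φ.free, V X = V' X) → φ.denot K V = φ.denot K V' := by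
  induction φ with
  | ff => intros; rfl
  | tt => intros; rfl
  | atom a => intros; rfl
  | not φ ih => intro V V' h; simp only [GMC.denot]; rw [ih V V' h]
  | and φ ψ ih1 ih2 =>
    intro V V' h; simp only [GMC.denot]
    rw [ih1 V V' (fun X hX => h X (Or.inl hX)), ih2 V V' (fun X hX => h X (Or.inr hX))]
  | or φ ψ ih1 ih2 =>
    intro V V' h; simp only [GMC.denot]
    rw [ih1 V V' (fun X hX => h X (Or.inl hX)), ih2 V V' (fun X hX => h X (Or.inr hX))]
  | var X => intro V V' h; exact h X rfl
  | dia k φ ih => intro V V' h; simp only [GMC.denot]; rw [ih V V' h]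
  | box k φ ih => intro V V' h; simp only [GMC.denot]; rw [ih V V' h]
  | mu X φ ih =>
    intro V V' h; simp only [GMC.denot]
    have : ∀ W, φ.denot K (Function.update V X W) = φ.denot K (Function.update V' X W) := by
      intro W
      apply ih
      intro Y hY
      by_cases hYX : Y = X
      · subst hYX; simp
      · simp [hYX, h Y ⟨hY, hYX⟩]
    simp only [this]
  | nu X φ ih =>
    intro V V' h; simp only [GMC.denot]
    have : ∀ W, φ.denot K (Function.update V X W) = φ.denot K (Function.update V' X W) := by
      intro W
      apply ih
      intro Y hY
      by_cases hYX : Y = X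
      · subst hYX; simp
      · simp [hYX, h Y ⟨hY, hYX⟩]
    simp only [this]

theorem denot_mono (K : KripkeTree AP) (φ : GMC AP) :
    ∀ (V V' : ℕ → Set Node) (b : Bool), (∀ X, V X ⊆ V' X) →
      (∀ X, V X = V' X ∨ φ.polOK X b) →
      (b = true → φ.denot K V ⊆ φ.denot K V') ∧ (b = false → φ.denot K V' ⊆ φ.denot K V) := by
  induction φ with
  | ff => intros; simp [GMC.denot]
  | tt => intros; simp [GMC.denot]
  | atom a => intros; simp [GMC.denot]
  | not φ ih =>
    intro V V' b h1 h2
    have := ih V V' (!b) h1 h2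
    simp only [GMC.denot]
    constructor
    · rintro rfl; exact Set.sdiff_subset_sdiff_right (this.2 rfl)
    · rintro rfl; exact Set.sdiff_subset_sdiff_right (this.1 rfl)
  | and φ ψ ih1 ih2 =>
    intro V V' b h1 h2
    have a1 := ih1 V V' b h1 (fun X => (h2 X).imp_right And.left)
    have a2 := ih2 V V' b h1 (fun X => (h2 X).imp_right And.right)
    exact ⟨fun h => Set.inter_subset_inter (a1.1 h) (a2.1 h),
      fun h => Set.inter_subset_inter (a1.2 h) (a2.2 h)⟩
  | or φ ψ ih1 ih2 =>
    intro V V' b h1 h2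
    have a1 := ih1 V V' b h1 (fun X => (h2 X).imp_right And.left)
    have a2 := ih2 V V' b h1 (fun X => (h2 X).imp_right And.right)
    exact ⟨fun h => Set.union_subset_union (a1.1 h) (a2.1 h),
      fun h => Set.union_subset_union (a1.2 h) (a2.2 h)⟩
  | var X =>
    intro V V' b h1 h2
    refine ⟨fun _ => h1 X, ?_⟩
    rintro rfl
    rcases h2 X with h | h
    · exact h.symm.subset
    · simp [GMC.polOK] at h
  | dia k φ ih =>
    intro V V' b h1 h2
    have a := ih V V' b h1 h2
    exact ⟨fun h τ hτ => ⟨hτ.1, atLeast_mono (Set.inter_subset_inter_right _ (a.1 h)) hτ.2⟩,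
      fun h τ hτ => ⟨hτ.1, atLeast_mono (Set.inter_subset_inter_right _ (a.2 h)) hτ.2⟩⟩
  | box k φ ih =>
    intro V V' b h1 h2
    have a := ih V V' b h1 h2
    exact ⟨fun h τ hτ => ⟨hτ.1, fun hh => hτ.2 (atLeast_mono (Set.sdiff_subset_sdiff_right (a.1 h)) hh)⟩,
      fun h τ hτ => ⟨hτ.1, fun hh => hτ.2 (atLeast_mono (Set.sdiff_subset_sdiff_right (a.2 h)) hh)⟩⟩
  | mu Y φ ih =>
    intro V V' b h1 h2
    have a := fun W => ih (Function.update V Y W) (Function.update V' Y W) b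
      (fun X => by
        by_cases hX : X = Y
        · subst hX; simp
        · simp [hX, h1 X])
      (fun X => by
        by_cases hX : X = Y
        · subst hX; simp
        · simp only [Function.update_of_ne hX]
          refine (h2 X).imp_right fun h => ?_
          exact h.resolve_left (fun h => hX h.symm))
    exact ⟨fun h => Set.sInter_subset_sInter fun W hW => ⟨hW.1, ((a W).1 h).trans hW.2⟩,
      fun h => Set.sInter_subset_sInter fun W hW => ⟨hW.1, ((a W).2 h).trans hW.2⟩⟩
  | nu Y φ ih =>
    intro V V' b h1 h2
    have a := fun W => ih (Function.update V Y W) (Function.update V' Y W) b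
      (fun X => by
        by_cases hX : X = Y
        · subst hX; simp
        · simp [hX, h1 X])
      (fun X => by
        by_cases hX : X = Y
        · subst hX; simp
        · simp only [Function.update_of_ne hX]
          refine (h2 X).imp_right fun h => ?_
          exact h.resolve_left (fun h => hX h.symm))
    exact ⟨fun h => Set.sUnion_subset_sUnion fun W hW => ⟨hW.1, hW.2.trans ((a W).1 h)⟩,
      fun h => Set.sUnion_subset_sUnion fun W hW => ⟨hW.1, hW.2.trans ((a W).2 h)⟩⟩

theorem update_sub {T : Set Node} {V : ℕ → Set Node} (hV : ∀ X, V X ⊆ T) {W : Set Node}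
    (hW : W ⊆ T) (X : ℕ) : ∀ Y, Function.update V X W Y ⊆ T := by
  intro Y
  by_cases h : Y = X
  · subst h; simpa using hW
  · simpa [h] using hV Y

theorem denot_sub (K : KripkeTree AP) (φ : GMC AP) :
    ∀ V : ℕ → Set Node, (∀ X, V X ⊆ K.T) → φ.denot K V ⊆ K.T := by
  induction φ with
  | ff => intros; simp [GMC.denot]
  | tt => intros; simp [GMC.denot]
  | atom a => intro V _ x hx; exact hx.1
  | not φ ih => intro V _ x hx; exact hx.1
  | and φ ψ ih1 ih2 => intro V h x hx; exact ih1 V h hx.1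
  | or φ ψ ih1 ih2 => intro V h x hx; exact hx.elim (fun h' => ih1 V h h') (fun h' => ih2 V h h')
  | var X => intro V h; exact h X
  | dia k φ ih => intro V _ x hx; exact hx.1
  | box k φ ih => intro V _ x hx; exact hx.1
  | mu X φ ih =>
    intro V h
    exact Set.sInter_subset_of_mem ⟨subset_rfl, ih _ (update_sub h subset_rfl X)⟩
  | nu X φ ih =>
    intro V h
    exact Set.sUnion_subset fun W hW => hW.1

/-! ### definability -/

def Dfn (F1 F2 : Set ℕ) (R : KripkeTree AP → (ℕ → Node) → (ℕ → Set Node) → Prop) : Prop :=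
  ∃ ψ : MSOL AP, ψ.freeFO ⊆ F1 ∧ ψ.freeSO ⊆ F2 ∧
    ∀ K : KripkeTree AP, FinBranching K.T → ∀ V1 V2, Sat WD K V1 V2 ψ ↔ R K V1 V2

variable {F1 F2 : Set ℕ} {R R' : KripkeTree AP → (ℕ → Node) → (ℕ → Set Node) → Prop}

theorem Dfn.congr (h : Dfn F1 F2 R)
    (e : ∀ K : KripkeTree AP, FinBranching K.T → ∀ V1 V2, R K V1 V2 ↔ R' K V1 V2) :
    Dfn F1 F2 R' := by
  obtain ⟨ψ, h1, h2, h3⟩ := h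
  exact ⟨ψ, h1, h2, fun K hK V1 V2 => (h3 K hK V1 V2).trans (e K hK V1 V2)⟩

theorem Dfn.weaken {G1 G2 : Set ℕ} (h : Dfn F1 F2 R) (h1 : F1 ⊆ G1) (h2 : F2 ⊆ G2) :
    Dfn G1 G2 R := by
  obtain ⟨ψ, a1, a2, a3⟩ := h
  exact ⟨ψ, a1.trans h1, a2.trans h2, a3⟩

theorem Dfn.not (h : Dfn F1 F2 R) : Dfn F1 F2 (fun K V1 V2 => ¬ R K V1 V2) := by
  obtain ⟨ψ, a1, a2, a3⟩ := h
  exact ⟨.not ψ, a1, a2, fun K hK V1 V2 => not_congr (a3 K hK V1 V2)⟩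

theorem Dfn.and (h : Dfn F1 F2 R) (h' : Dfn F1 F2 R') :
    Dfn F1 F2 (fun K V1 V2 => R K V1 V2 ∧ R' K V1 V2) := by
  obtain ⟨ψ, a1, a2, a3⟩ := h
  obtain ⟨ψ', b1, b2, b3⟩ := h'
  exact ⟨.and ψ ψ', Set.union_subset a1 b1, Set.union_subset a2 b2,
    fun K hK V1 V2 => and_congr (a3 K hK V1 V2) (b3 K hK V1 V2)⟩

theorem Dfn.or (h : Dfn F1 F2 R) (h' : Dfn F1 F2 R') :
    Dfn F1 F2 (fun K V1 V2 => R K V1 V2 ∨ R' K V1 V2) :=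
  (h.not.and h'.not).not.congr (by intros; tauto)

theorem Dfn.imp (h : Dfn F1 F2 R) (h' : Dfn F1 F2 R') :
    Dfn F1 F2 (fun K V1 V2 => R K V1 V2 → R' K V1 V2) :=
  (h.and h'.not).not.congr (by intros; tauto)

theorem Dfn.exFO (x : ℕ) (h : Dfn (insert x F1) F2 R) :
    Dfn F1 F2 (fun K V1 V2 => ∃ τ ∈ K.T, R K (Function.update V1 x τ) V2) := by
  obtain ⟨ψ, a1, a2, a3⟩ := h
  refine ⟨.exFO x ψ, ?_, a2, fun K hK V1 V2 => ?_⟩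
  · rintro y ⟨hy, hyx⟩
    exact (a1 hy).resolve_left hyx
  · simp only [Sat, a3 K hK]

theorem Dfn.exSO (x : ℕ) (h : Dfn F1 (insert x F2) R) :
    Dfn F1 F2 (fun K V1 V2 => ∃ S ∈ WD K.T, R K V1 (Function.update V2 x S)) := by
  obtain ⟨ψ, a1, a2, a3⟩ := h
  refine ⟨.exSO x ψ, a1, ?_, fun K hK V1 V2 => ?_⟩
  · rintro y ⟨hy, hyx⟩
    exact (a2 hy).resolve_left hyx
  · simp only [Sat, a3 K hK]

theorem Dfn.allFO (x : ℕ) (h : Dfn (insert x F1) F2 R) :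
    Dfn F1 F2 (fun K V1 V2 => ∀ τ ∈ K.T, R K (Function.update V1 x τ) V2) :=
  (Dfn.exFO x h.not).not.congr (by intros; push Not; rfl)

theorem Dfn.allSO (x : ℕ) (h : Dfn F1 (insert x F2) R) :
    Dfn F1 F2 (fun K V1 V2 => ∀ S ∈ WD K.T, R K V1 (Function.update V2 x S)) :=
  (Dfn.exSO x h.not).not.congr (by intros; push Not; rfl)

theorem dfn_le (x y : ℕ) (hx : x ∈ F1) (hy : y ∈ F1) : Dfn (AP := AP) F1 F2
    (fun K V1 _ => V1 x ∈ K.T ∧ V1 y ∈ K.T ∧ V1 x <+: V1 y) :=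
  ⟨.le x y, by rintro z (rfl | rfl) <;> assumption, by simp [MSOL.freeSO], fun _ _ _ _ => Iff.rfl⟩

theorem dfn_mem (x X : ℕ) (hx : x ∈ F1) (hX : X ∈ F2) : Dfn (AP := AP) F1 F2
    (fun _ V1 V2 => V1 x ∈ V2 X) :=
  ⟨.mem x X, by rintro z rfl; assumption, by rintro z rfl; assumption, fun _ _ _ _ => Iff.rfl⟩

theorem dfn_atom (x : ℕ) (a : AP) (hx : x ∈ F1) : Dfn (AP := AP) F1 F2
    (fun K V1 _ => V1 x ∈ K.T ∧ a ∈ K.Lab (V1 x)) :=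
  ⟨.atom a x, by rintro z rfl; assumption, by simp [MSOL.freeSO], fun _ _ _ _ => Iff.rfl⟩

theorem dfn_T (x : ℕ) (hx : x ∈ F1) : Dfn (AP := AP) F1 F2 (fun K V1 _ => V1 x ∈ K.T) :=
  (dfn_le x x hx hx).congr (by intros; simp)

theorem dfn_eq (x y : ℕ) (hx : x ∈ F1) (hy : y ∈ F1) : Dfn (AP := AP) F1 F2
    (fun K V1 _ => V1 x ∈ K.T ∧ V1 x = V1 y) :=
  ((dfn_le x y hx hy).and (dfn_le y x hy hx)).congr (by
    intro K _ V1 V2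
    constructor
    · rintro ⟨⟨h1, h2, h3⟩, -, -, h4⟩
      exact ⟨h1, h3.eq_of_length_le h4.length_le⟩
    · rintro ⟨h1, h2⟩
      rw [← h2]
      simp [h1])

theorem dfn_true : Dfn (AP := AP) F1 F2 (fun _ _ _ => True) :=
  (Dfn.exFO 0 (dfn_T (AP := AP) (F1 := insert 0 F1) 0 (by simp))).congr (by
    intro K _ V1 V2
    simpa using ⟨_, K.rooted.1⟩)

theorem child_iff (K : KripkeTree AP) (x y : Node) (hx : x ∈ K.T) :
    childIn K.T x y ↔ y ∈ K.T ∧ x <+: y ∧ x ≠ y ∧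
      ¬ ∃ z ∈ K.T, x <+: z ∧ z <+: y ∧ x ≠ z ∧ z ≠ y := by
  have hr := (rooted_iff _ _).1 K.rooted
  constructor
  · rintro ⟨hy, n, rfl⟩
    refine ⟨hy, ⟨[n], rfl⟩, by simp, ?_⟩
    rintro ⟨z, -, h1, h2, h3, h4⟩
    rcases List.prefix_concat_iff.1 h2 with h | h
    · exact h4 h
    · exact h3 (h1.eq_of_length_le h.length_le)
  · rintro ⟨hy, ⟨t, rfl⟩, h1, h2⟩
    refine ⟨hy, ?_⟩
    rcases t with _ | ⟨n, u⟩
    · simp at h1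
    · refine ⟨n, ?_⟩
      by_contra hne
      apply h2
      have hp : x ++ [n] <+: x ++ n :: u := ⟨u, by simp⟩
      exact ⟨x ++ [n], hr.2.2 _ hy _ ((hr.2.1 x hx).trans ⟨[n], rfl⟩) hp, ⟨[n], rfl⟩, hp,
        by simp, fun h => hne h.symm⟩

theorem dfn_child (x y : ℕ) (hx : x ∈ F1) (hy : y ∈ F1) : Dfn (AP := AP) F1 F2
    (fun K V1 _ => V1 x ∈ K.T ∧ childIn K.T (V1 x) (V1 y)) := by
  have hxz : x ≠ x + y + 1 := by omega
  have hyz : y ≠ x + y + 1 := by omega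
  have hx' : x ∈ insert (x + y + 1) F1 := Or.inr hx
  have hy' : y ∈ insert (x + y + 1) F1 := Or.inr hy
  have hz' : x + y + 1 ∈ insert (x + y + 1) F1 := Or.inl rfl
  refine (((dfn_le x y hx hy).and (dfn_eq x y hx hy).not).and
    (Dfn.exFO (x + y + 1) (((dfn_le x _ hx' hz').and (dfn_le _ y hz' hy')).and
      ((dfn_eq x _ hx' hz').not.and (dfn_eq _ y hz' hy').not))).not).congr ?_
  intro K _ V1 V2
  simp only [Function.update_self, Function.update_of_ne hxz, Function.update_of_ne hyz]
  by_cases hxT : V1 x ∈ K.T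
  · rw [child_iff K _ _ hxT]
    constructor
    · rintro ⟨⟨⟨-, h2, h3⟩, h4⟩, h5⟩
      refine ⟨hxT, h2, h3, fun h => h4 ⟨hxT, h⟩, ?_⟩
      rintro ⟨z, hz, a1, a2, a3, a4⟩
      exact h5 ⟨z, hz, ⟨⟨hxT, hz, a1⟩, hz, h2, a2⟩, fun h => a3 h.2, fun h => a4 h.2⟩
    · rintro ⟨-, h2, h3, h4, h5⟩
      refine ⟨⟨⟨hxT, h2, h3⟩, fun h => h4 h.2⟩, ?_⟩
      rintro ⟨z, hz, ⟨⟨-, -, a1⟩, -, -, a2⟩, a3, a4⟩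
      exact h5 ⟨z, hz, a1, a2, fun h => a3 ⟨hxT, h⟩, fun h => a4 ⟨hz, h⟩⟩
  · simp [hxT]

theorem atLeast_zero (A : Set Node) : GMC.atLeast 0 A := ⟨∅, rfl, by simp⟩

theorem atLeast_succ (k : ℕ) (A : Set Node) :
    GMC.atLeast (k + 1) A ↔ ∃ y ∈ A, GMC.atLeast k (A \ {y}) := by
  constructor
  · rintro ⟨F, h1, h2⟩
    obtain ⟨y, hy⟩ : F.Nonempty := by
      rw [← Finset.card_pos]; omega
    refine ⟨y, h2 hy, F.erase y, by rw [Finset.card_erase_of_mem hy]; omega, ?_⟩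
    intro z hz
    simp only [Finset.coe_erase, Set.mem_sdiff] at hz
    exact ⟨h2 hz.1, hz.2⟩
  · rintro ⟨y, hy, F, h1, h2⟩
    refine ⟨insert y F, ?_, ?_⟩
    · rw [Finset.card_insert_of_notMem (fun h => (h2 h).2 rfl), h1]
    · intro z hz
      simp only [Finset.coe_insert, Set.mem_insert_iff] at hz
      rcases hz with rfl | hz
      · exact hy
      · exact (h2 hz).1

/-- inequality to finitely many variables -/
theorem dfn_ne (y : ℕ) (l : List ℕ) (hy : y ∈ F1) (hl : ∀ i ∈ l, i ∈ F1) :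
    Dfn (AP := AP) F1 F2 (fun K V1 _ => V1 y ∈ K.T ∧ ∀ i ∈ l, V1 y ≠ V1 i) := by
  induction l with
  | nil => exact (dfn_T y hy).congr (by simp)
  | cons a l ih =>
    refine ((dfn_eq y a hy (hl a (by simp))).not.and (ih fun i hi => hl i (by simp [hi]))).congr ?_
    intro K _ V1 V2
    simp only [List.mem_cons, forall_eq_or_imp]
    tauto

/-- counting children satisfying a definable property -/
theorem dfn_atLeast (x : ℕ) (P : KripkeTree AP → (ℕ → Set Node) → Set Node)
    (hP : ∀ y, Dfn {y} F2 (fun K V1 V2 => V1 y ∈ P K V2)) (k : ℕ) :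
    Dfn {x} F2 (fun K V1 V2 => V1 x ∈ K.T ∧
      GMC.atLeast k (GMC.childrenIn K.T (V1 x) ∩ P K V2)) := by
  have main : ∀ j (l : List ℕ), (∀ i ∈ l, x + j < i) →
      Dfn (insert x {i | i ∈ l}) F2 (fun K V1 V2 => V1 x ∈ K.T ∧
        GMC.atLeast j ((GMC.childrenIn K.T (V1 x) ∩ P K V2) \ {v | ∃ i ∈ l, v = V1 i})) := by
    intro j
    induction j with
    | zero =>
      intro l _
      exact (dfn_T x (by simp)).congr (by intros; simp [atLeast_zero])
    | succ j ih =>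
      intro l hl
      have hx1 : x ≠ x + (j + 1) := by omega
      have h1 := ih ((x + (j + 1)) :: l) (by
        intro i hi
        rcases List.mem_cons.1 hi with rfl | hi
        · omega
        · have := hl i hi; omega)
      have e : insert x {i | i ∈ (x + (j + 1)) :: l} = insert (x + (j + 1)) (insert x {i | i ∈ l}) := by
        ext i; simp; tauto
      rw [e] at h1
      have h2 := (hP (x + (j + 1))).weaken (G1 := insert (x + (j + 1)) (insert x {i | i ∈ l}))
        (G2 := F2) (by simp) subset_rfl
      have h3 := dfn_child (AP := AP) (F1 := insert (x + (j + 1)) (insert x {i | i ∈ l}))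
        (F2 := F2) x (x + (j + 1)) (by simp) (by simp)
      have h4 := dfn_ne (AP := AP) (F1 := insert (x + (j + 1)) (insert x {i | i ∈ l}))
        (F2 := F2) (x + (j + 1)) l (by simp) (by intro i hi; simp [hi])
      refine (Dfn.exFO (x + (j + 1)) ((h1.and h2).and (h3.and h4))).congr ?_
      intro K _ V1 V2
      rw [atLeast_succ]
      have hl' : ∀ τ, ∀ i ∈ l, Function.update V1 (x + (j + 1)) τ i = V1 i := by
        intro τ i hi
        have := hl i hi
        rw [Function.update_of_ne]
        omega
      have es : ∀ τ : Node, (GMC.childrenIn K.T (V1 x) ∩ P K V2) \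
          {v | ∃ i ∈ (x + (j + 1)) :: l, v = Function.update V1 (x + (j + 1)) τ i} =
          ((GMC.childrenIn K.T (V1 x) ∩ P K V2) \ {v | ∃ i ∈ l, v = V1 i}) \ {τ} := by
        intro τ
        ext v
        simp only [Set.mem_sdiff, Set.mem_ofPred_eq, List.mem_cons, exists_eq_or_imp,
          Function.update_self, Set.mem_singleton_iff, not_or]
        have : (∃ i ∈ l, v = Function.update V1 (x + (j + 1)) τ i) ↔ (∃ i ∈ l, v = V1 i) := by
          constructor
          · rintro ⟨i, hi, h⟩; exact ⟨i, hi, by rw [h, hl' τ i hi]⟩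
          · rintro ⟨i, hi, h⟩; exact ⟨i, hi, by rw [h, hl' τ i hi]⟩
        rw [this]
        tauto
      simp only [Function.update_self, Function.update_of_ne hx1, es]
      constructor
      · rintro ⟨τ, hτ, ⟨⟨a1, a2⟩, a3⟩, ⟨-, a4⟩, -, a5⟩
        refine ⟨a1, τ, ⟨⟨a4, a3⟩, ?_⟩, a2⟩
        rintro ⟨i, hi, rfl⟩
        exact a5 i hi (hl' _ i hi).symm
      · rintro ⟨a1, τ, ⟨⟨a4, a3⟩, a5⟩, a2⟩
        refine ⟨τ, a4.1, ⟨⟨a1, a2⟩, a3⟩, ⟨a1, a4⟩, a4.1, ?_⟩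
        intro i hi h
        rw [hl' τ i hi] at h
        exact a5 ⟨i, hi, h⟩
  have := main k [] (by simp)
  simpa using this

/-! ### one-step formulas -/

def val (b : Bool) (K : KripkeTree AP) (W : Set Node) : Set Node := if b then W else K.T \ W

structure Good (Z O : Set ℕ) (φ : GMC AP) : Prop where
  fr : φ.free ⊆ Z ∪ O
  loc : ∀ (K : KripkeTree AP) (V V' : ℕ → Set Node) (σ : Node),
    (∀ X ∈ Z, (σ ∈ V X ↔ σ ∈ V' X)) →
    (∀ X ∈ O, ∀ c ∈ GMC.childrenIn K.T σ, (c ∈ V X ↔ c ∈ V' X)) →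
    (σ ∈ φ.denot K V ↔ σ ∈ φ.denot K V')
  dfn : ∀ (b : Bool) (x : ℕ),
    Dfn {x} {0} (fun K V1 V2 => V1 x ∈ φ.denot K (fun _ => val b K (V2 0)))

open Classical in
def asg (V : ℕ → Set Node) (B : Set ℕ) (W : Set Node) : ℕ → Set Node :=
  fun X => if X ∈ B then W else V X

def fp (b : Bool) (T : Set Node) (f : Set Node → Set Node) : Set Node :=
  if b then gf T f else lf T f

/-- `θ` is semantically one `b`-fixpoint over a one-step body. -/
def Shape (b : Bool) (Z O : Set ℕ) (θ : GMC AP) : Prop :=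
  ∃ (φ : GMC AP) (B : Set ℕ), Good (Z ∪ B) (O ∪ B) φ ∧ (∀ X ∈ B, φ.polOK X true) ∧
    (∀ X, θ.polOK X true → X ∈ B ∨ φ.polOK X true) ∧
    ∀ (K : KripkeTree AP) (V : ℕ → Set Node), (∀ X, V X ⊆ K.T) →
      θ.denot K V = fp b K.T (fun W => φ.denot K (asg V B W))

theorem asg_sub {T : Set Node} {V : ℕ → Set Node} (hV : ∀ X, V X ⊆ T) {W : Set Node}
    (hW : W ⊆ T) (B : Set ℕ) : ∀ Y, asg V B W Y ⊆ T := by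
  intro Y
  unfold asg
  split_ifs
  · exact hW
  · exact hV Y

theorem asg_mono (K : KripkeTree AP) (φ : GMC AP) (V : ℕ → Set Node) (B : Set ℕ)
    (hB : ∀ X ∈ B, φ.polOK X true) {W W' : Set Node} (h : W ⊆ W') :
    φ.denot K (asg V B W) ⊆ φ.denot K (asg V B W') := by
  refine (denot_mono K φ _ _ true ?_ ?_).1 rfl
  · intro X; unfold asg; split_ifs
    · exact h
    · exact subset_rfl
  · intro X
    by_cases hX : X ∈ B
    · right; exact hB X hX
    · left; simp [asg, hX]

theorem dfn_gf (F : KripkeTree AP → Set Node → Set Node)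
    (hF : ∀ K, OneStep K.T (F K))
    (hd : ∀ y, Dfn {y} {0} (fun K V1 V2 => V1 y ∈ F K (V2 0))) (x : ℕ) :
    Dfn {x} ∅ (fun K V1 _ => V1 x ∈ gf K.T (F K)) := by
  have h1 := (hd (x + 1)).weaken (G1 := insert (x + 1) {x}) (G2 := insert 0 (insert 1 ∅))
    (by simp) (by simp)
  have h2 := dfn_mem (AP := AP) (F1 := insert (x + 1) {x}) (F2 := insert 0 (insert 1 ∅))
    (x + 1) 0 (by simp) (by simp)
  have h3 := dfn_mem (AP := AP) (F1 := insert (x + 1) {x}) (F2 := insert 0 (insert 1 ∅))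
    (x + 1) 1 (by simp) (by simp)
  have h4 := dfn_mem (AP := AP) (F1 := {x}) (F2 := insert 0 (insert 1 ∅))
    x 0 (by simp) (by simp)
  refine ((dfn_T x (Set.mem_singleton x)).and (Dfn.allSO 1 (Dfn.exSO 0
    (h4.and (Dfn.allFO (x + 1) (h2.imp (h3.imp h1))))))).congr ?_
  intro K hK V1 V2
  rw [gf_eq K hK _ (hF K)]
  simp [GG]

theorem shape_closed (b : Bool) (θ : GMC AP) (h : Shape b ∅ ∅ θ) (x : ℕ) :
    Dfn {x} ∅ (fun K V1 _ => V1 x ∈ θ.denot K (fun _ => ∅)) := by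
  obtain ⟨φ, B, hG, hB, -, hd⟩ := h
  simp only [Set.empty_union] at hG
  have hsame : ∀ (K : KripkeTree AP) W, φ.denot K (asg (fun _ => ∅) B W) = φ.denot K (fun _ => W) := by
    intro K W
    ext σ
    apply hG.loc
    · intro X hX; simp [asg, hX]
    · intro X hX; simp [asg, hX]
  have hO : ∀ K : KripkeTree AP, OneStep K.T (fun W => φ.denot K (fun _ => W)) := by
    intro K
    refine ⟨?_, ?_, ?_⟩
    · intro W hW; exact denot_sub K φ _ (fun _ => hW)
    · intro W W' _ _ h
      simp only [← hsame]
      exact asg_mono K φ _ B hB h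
    · intro W W' σ _ _ _ h1 h2
      exact hG.loc K _ _ σ (fun _ _ => h1) (fun _ _ => h2)
  have hd' : ∀ K : KripkeTree AP,
      θ.denot K (fun _ => ∅) = fp b K.T (fun W => φ.denot K (fun _ => W)) := by
    intro K
    rw [hd K _ (by simp)]
    simp only [hsame]
  simp only [hd']
  cases b with
  | true =>
    exact dfn_gf (fun K W => φ.denot K (fun _ => W)) hO (fun y => hG.dfn true y) x
  | false =>
    have h1 := dfn_gf (fun K => dual K.T (fun W => φ.denot K (fun _ => W)))
      (fun K => dual_oneStep (hO K))
      (fun y => ((dfn_T y (Set.mem_singleton y)).and (hG.dfn false y).not).congr (by intros; rfl)) x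
    refine ((dfn_T x (Set.mem_singleton x)).and h1.not).congr ?_
    intro K _ V1 V2
    have e : fp false K.T (fun W => φ.denot K (fun _ => W)) =
      lf K.T (fun W => φ.denot K (fun _ => W)) := rfl
    rw [e, lf_eq (hO K)]
    rfl

theorem good_closed (Z O : Set ℕ) (θ : GMC AP) (hfr : θ.free ⊆ ∅)
    (h : ∀ x, Dfn {x} ∅ (fun K V1 _ => V1 x ∈ θ.denot K (fun _ => ∅))) : Good Z O θ where
  fr := hfr.trans (Set.empty_subset _)
  loc := by
    intro K V V' σ _ _
    rw [denot_free K θ V V' (fun X hX => (hfr hX).elim)]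
  dfn := by
    intro b x
    refine ((h x).weaken subset_rfl (Set.empty_subset _)).congr ?_
    intro K _ V1 V2
    rw [denot_free K θ (fun _ => ∅) (fun _ => val b K (V2 0)) (fun X hX => (hfr hX).elim)]

theorem shape_base (b : Bool) (Z O : Set ℕ) (φ : GMC AP) (h : Good Z O φ) : Shape b Z O φ := by
  refine ⟨φ, ∅, by simpa using h, by simp, fun X hX => Or.inr hX, ?_⟩
  intro K V hV
  have e : ∀ W, asg V ∅ W = V := by intro W; funext X; simp [asg]
  simp only [e]
  have hs := denot_sub K φ V hV
  cases b with
  | true =>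
    apply Set.Subset.antisymm
    · exact Set.subset_sUnion_of_mem ⟨hs, subset_rfl⟩
    · exact Set.sUnion_subset fun W hW => hW.2
  | false =>
    apply Set.Subset.antisymm
    · exact Set.subset_sInter fun W hW => hW.2
    · exact Set.sInter_subset_of_mem ⟨hs, subset_rfl⟩

def bind (b : Bool) (X : ℕ) (θ : GMC AP) : GMC AP := if b then .nu X θ else .mu X θ

theorem denot_bind (b : Bool) (X : ℕ) (θ : GMC AP) (K : KripkeTree AP) (V : ℕ → Set Node) :
    (bind b X θ).denot K V = fp b K.T (fun W => θ.denot K (Function.update V X W)) := by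
  cases b <;> rfl

theorem fp_congr (b : Bool) (T : Set Node) (f g : Set Node → Set Node)
    (h : ∀ W, W ⊆ T → f W = g W) : fp b T f = fp b T g := by
  cases b
  · show lf T f = lf T g
    unfold lf
    congr 1; ext W; constructor
    · rintro ⟨a, b⟩; exact ⟨a, by rwa [← h W a]⟩
    · rintro ⟨a, b⟩; exact ⟨a, by rwa [h W a]⟩
  · show gf T f = gf T g
    unfold gf
    congr 1; ext W; constructor
    · rintro ⟨a, b⟩; exact ⟨a, by rwa [← h W a]⟩
    · rintro ⟨a, b⟩; exact ⟨a, by rwa [h W a]⟩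

theorem shape_bind (b : Bool) (Z O : Set ℕ) (X : ℕ) (θ : GMC AP)
    (h : Shape b (Z ∪ {X}) (O ∪ {X}) θ) (hp : θ.polOK X true) : Shape b Z O (bind b X θ) := by
  obtain ⟨φ, B, hG, hB, hpol, hd⟩ := h
  have hB' : ∀ Y ∈ {X} ∪ B, φ.polOK Y true := by
    rintro Y (rfl | hY)
    · rcases hpol Y hp with h | h
      · exact hB Y h
      · exact h
    · exact hB Y hY
  refine ⟨φ, {X} ∪ B, by rw [← Set.union_assoc, ← Set.union_assoc]; exact hG, hB', ?_, ?_⟩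
  · intro Y hY
    have : X = Y ∨ θ.polOK Y true := by cases b <;> exact hY
    rcases this with rfl | h
    · left; simp
    · rcases hpol Y h with h | h
      · left; right; exact h
      · right; exact h
  · intro K V hV
    rw [denot_bind]
    rw [fp_congr b K.T _ (fun W => fp b K.T
      (fun U => φ.denot K (asg (Function.update V X W) B U)))
      (fun W hW => hd K _ (update_sub hV hW X))]
    have hs : ∀ W U, W ⊆ K.T → U ⊆ K.T →
        φ.denot K (asg (Function.update V X W) B U) ⊆ K.T := fun W U hW hU =>
      denot_sub K φ _ (asg_sub (update_sub hV hW X) hU B)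
    have hm : ∀ W W' U U', W ⊆ K.T → W' ⊆ K.T → U ⊆ K.T → U' ⊆ K.T → W ⊆ W' → U ⊆ U' →
        φ.denot K (asg (Function.update V X W) B U) ⊆
        φ.denot K (asg (Function.update V X W') B U') := by
      intro W W' U U' _ _ _ _ hW hU
      refine (denot_mono K φ _ _ true ?_ ?_).1 rfl
      · intro Y
        unfold asg
        split_ifs
        · exact hU
        · by_cases hY : Y = X
          · subst hY; simpa using hW
          · simp [hY]
      · intro Y
        by_cases hY : Y ∈ {X} ∪ B
        · right; exact hB' Y hY
        · left
          simp only [Set.mem_union, Set.mem_singleton_iff, not_or] at hY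
          simp [asg, hY.1, hY.2]
    have e : ∀ U, asg (Function.update V X U) B U = asg V ({X} ∪ B) U := by
      intro U
      funext Y
      unfold asg
      by_cases h1 : Y ∈ B
      · simp [h1]
      · by_cases h2 : Y = X
        · subst h2; simp
        · simp [h1, h2]
    cases b
    · have := lf_diag K.T (fun W U => φ.denot K (asg (Function.update V X W) B U)) hs hm
      simp only [e] at this
      exact this
    · have := gf_diag K.T (fun W U => φ.denot K (asg (Function.update V X W) B U)) hs hm
      simp only [e] at this
      exact this

theorem free_bind (b : Bool) (X : ℕ) (θ : GMC AP) : (bind b X θ).free = θ.free \ {X} := by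
  cases b <;> rfl

/-- binding a variable that is not free changes nothing -/
theorem shape_vacuous (b c : Bool) (Z O : Set ℕ) (X : ℕ) (θ : GMC AP)
    (h : Shape b (Z ∪ {X}) (O ∪ {X}) θ) (hp : θ.polOK X true) (hX : X ∉ θ.free) :
    Shape b Z O (bind c X θ) := by
  have h1 := shape_bind b Z O X θ h hp
  obtain ⟨φ, B, hG, hB, hpol, hd⟩ := h1
  refine ⟨φ, B, hG, hB, ?_, ?_⟩
  · intro Y hY
    apply hpol
    cases b <;> cases c <;> exact hY
  · intro K V hV
    rw [← hd K V hV, denot_bind, denot_bind]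
    have e : ∀ W, θ.denot K (Function.update V X W) = θ.denot K V := by
      intro W
      apply denot_free
      intro Y hY
      have : Y ≠ X := fun h => hX (h ▸ hY)
      simp [this]
    simp only [e]
    have hs := denot_sub K θ V hV
    have a1 : lf K.T (fun _ => θ.denot K V) = θ.denot K V := by
      apply Set.Subset.antisymm
      · exact Set.sInter_subset_of_mem ⟨hs, subset_rfl⟩
      · exact Set.subset_sInter fun W hW => hW.2
    have a2 : gf K.T (fun _ => θ.denot K V) = θ.denot K V := by
      apply Set.Subset.antisymm
      · exact Set.sUnion_subset fun W hW => hW.2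
      · exact Set.subset_sUnion_of_mem ⟨hs, subset_rfl⟩
    cases b <;> cases c <;> simp [fp, a1, a2]

structure FixGood (Z O : Set ℕ) (θ : GMC AP) : Prop where
  fr : θ.free ⊆ Z ∪ O
  sh : (∀ b, Shape b Z O θ) ∨
    (Shape false Z O θ ∧ ∀ X, θ.noFreeInMu X → X ∉ θ.free) ∨
    (Shape true Z O θ ∧ ∀ X, θ.noFreeInNu X → X ∉ θ.free)

theorem FixGood.toGood {θ : GMC AP} (h : FixGood ∅ ∅ θ) (Z O : Set ℕ) : Good Z O θ := by
  refine good_closed Z O θ (by simpa using h.fr) ?_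
  rcases h.sh with h | h | h
  · exact shape_closed true θ (h true)
  · exact shape_closed false θ h.1
  · exact shape_closed true θ h.1

theorem free_sub_bind {Z O : Set ℕ} {X : ℕ} {A : Set ℕ} (h : A ⊆ (Z ∪ {X}) ∪ (O ∪ {X})) :
    A \ {X} ⊆ Z ∪ O := by
  rintro Y ⟨h1, h2⟩
  have := h h1
  simp only [Set.mem_union, Set.mem_singleton_iff] at this h2 ⊢
  tauto

theorem FixGood.mu {Z O : Set ℕ} {X : ℕ} {θ : GMC AP} (h : FixGood (Z ∪ {X}) (O ∪ {X}) θ)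
    (hp : θ.polOK X true) (hn : θ.noFreeInNu X) : FixGood Z O (.mu X θ) := by
  refine ⟨free_sub_bind h.fr, ?_⟩
  have first : Shape false (Z ∪ {X}) (O ∪ {X}) θ →
      (Shape false Z O (.mu X θ) ∧ ∀ Y, (GMC.mu X θ).noFreeInMu Y → Y ∉ (GMC.mu X θ).free) :=
    fun h => ⟨shape_bind false Z O X θ h hp, fun Y hY => hY⟩
  rcases h.sh with h | h | h
  · exact Or.inr (Or.inl (first (h false)))
  · exact Or.inr (Or.inl (first h.1))
  · refine Or.inr (Or.inr ⟨shape_vacuous true false Z O X θ h.1 hp (h.2 X hn), ?_⟩)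
    rintro Y (rfl | hY)
    · exact fun h => h.2 rfl
    · exact fun h' => h.2 Y hY h'.1

theorem FixGood.nu {Z O : Set ℕ} {X : ℕ} {θ : GMC AP} (h : FixGood (Z ∪ {X}) (O ∪ {X}) θ)
    (hp : θ.polOK X true) (hn : θ.noFreeInMu X) : FixGood Z O (.nu X θ) := by
  refine ⟨free_sub_bind h.fr, ?_⟩
  have first : Shape true (Z ∪ {X}) (O ∪ {X}) θ →
      (Shape true Z O (.nu X θ) ∧ ∀ Y, (GMC.nu X θ).noFreeInNu Y → Y ∉ (GMC.nu X θ).free) :=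
    fun h => ⟨shape_bind true Z O X θ h hp, fun Y hY => hY⟩
  rcases h.sh with h | h | h
  · exact Or.inr (Or.inr (first (h true)))
  · refine Or.inr (Or.inl ⟨shape_vacuous false true Z O X θ h.1 hp (h.2 X hn), ?_⟩)
    rintro Y (rfl | hY)
    · exact fun h => h.2 rfl
    · exact fun h' => h.2 Y hY h'.1
  · exact Or.inr (Or.inr (first h.1))

theorem good_ff (Z O : Set ℕ) : Good Z O (.ff : GMC AP) where
  fr := by simp [GMC.free]
  loc := by intros; simp [GMC.denot]
  dfn := fun b x => dfn_true.not.congr (by intros; simp [GMC.denot])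

theorem good_tt (Z O : Set ℕ) : Good Z O (.tt : GMC AP) where
  fr := by simp [GMC.free]
  loc := by intros; simp [GMC.denot]
  dfn := fun b x => (dfn_T x (Set.mem_singleton x)).congr (by intros; simp [GMC.denot])

theorem good_atom (Z O : Set ℕ) (a : AP) : Good Z O (.atom a : GMC AP) where
  fr := by simp [GMC.free]
  loc := by intros; simp [GMC.denot]
  dfn := fun b x => (dfn_atom x a (Set.mem_singleton x)).congr (by intros; simp [GMC.denot])

theorem good_not {Z O : Set ℕ} {φ : GMC AP} (h : Good Z O φ) : Good Z O (.not φ) where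
  fr := h.fr
  loc := by
    intro K V V' σ h1 h2
    simp only [GMC.denot, Set.mem_sdiff, h.loc K V V' σ h1 h2]
  dfn := fun b x => ((dfn_T x (Set.mem_singleton x)).and (h.dfn b x).not).congr (by intros; simp [GMC.denot])

theorem good_and {Z O : Set ℕ} {φ ψ : GMC AP} (h : Good Z O φ) (h' : Good Z O ψ) :
    Good Z O (.and φ ψ) where
  fr := Set.union_subset h.fr h'.fr
  loc := by
    intro K V V' σ h1 h2
    simp only [GMC.denot, Set.mem_inter_iff, h.loc K V V' σ h1 h2, h'.loc K V V' σ h1 h2]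
  dfn := fun b x => ((h.dfn b x).and (h'.dfn b x)).congr (by intros; simp [GMC.denot])

theorem good_or {Z O : Set ℕ} {φ ψ : GMC AP} (h : Good Z O φ) (h' : Good Z O ψ) :
    Good Z O (.or φ ψ) where
  fr := Set.union_subset h.fr h'.fr
  loc := by
    intro K V V' σ h1 h2
    simp only [GMC.denot, Set.mem_union, h.loc K V V' σ h1 h2, h'.loc K V V' σ h1 h2]
  dfn := fun b x => ((h.dfn b x).or (h'.dfn b x)).congr (by intros; simp [GMC.denot])

theorem good_var {Z O : Set ℕ} {X : ℕ} (hX : X ∈ Z) : Good Z O (.var X : GMC AP) where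
  fr := by rintro Y rfl; exact Or.inl hX
  loc := by
    intro K V V' σ h1 h2
    exact h1 X hX
  dfn := fun b x => by
    cases b
    · exact ((dfn_T x (Set.mem_singleton x)).and (dfn_mem x 0 (Set.mem_singleton x) (Set.mem_singleton 0)).not).congr (by intros; simp [GMC.denot, val])
    · exact (dfn_mem x 0 (Set.mem_singleton x) (Set.mem_singleton 0)).congr (by intros; simp [GMC.denot, val])

theorem good_dia {Z O : Set ℕ} {φ : GMC AP} (k : ℕ) (h : Good O ∅ φ) : Good Z O (.dia k φ) where
  fr := by
    intro X hX
    have := h.fr hX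
    simp only [Set.union_empty] at this
    exact Or.inr this
  loc := by
    intro K V V' σ h1 h2
    have e : GMC.childrenIn K.T σ ∩ φ.denot K V = GMC.childrenIn K.T σ ∩ φ.denot K V' := by
      ext c
      refine and_congr_right fun hc => h.loc K V V' c (fun X hX => h2 X hX c hc) (by simp)
    simp only [GMC.denot, Set.mem_ofPred_eq, e]
  dfn := fun b x =>
    (dfn_atLeast x (fun K V2 => φ.denot K (fun _ => val b K (V2 0))) (fun y => h.dfn b y) k).congr
      (by intros; simp [GMC.denot])

theorem good_box {Z O : Set ℕ} {φ : GMC AP} (k : ℕ) (h : Good O ∅ φ) : Good Z O (.box k φ) where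
  fr := by
    intro X hX
    have := h.fr hX
    simp only [Set.union_empty] at this
    exact Or.inr this
  loc := by
    intro K V V' σ h1 h2
    have e : GMC.childrenIn K.T σ \ φ.denot K V = GMC.childrenIn K.T σ \ φ.denot K V' := by
      ext c
      refine and_congr_right fun hc => not_congr
        (h.loc K V V' c (fun X hX => h2 X hX c hc) (by simp))
    simp only [GMC.denot, Set.mem_ofPred_eq, e]
  dfn := fun b x => by
    refine ((dfn_T x (Set.mem_singleton x)).and (dfn_atLeast x
      (fun K V2 => (φ.denot K (fun _ => val b K (V2 0)))ᶜ) (fun y => (h.dfn b y).not) k).not).congr ?_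
    intro K _ V1 V2
    simp only [GMC.denot, Set.mem_ofPred_eq, Set.diff_eq]
    tauto

mutual
  theorem base_good : ∀ {Z O : Set ℕ} {φ : GMC AP}, IsBase Z O φ → φ.boundPos → φ.AltFree →
      Good Z O φ
    | _, _, _, .ff, _, _ => good_ff _ _
    | _, _, _, .tt, _, _ => good_tt _ _
    | _, _, _, .atom a, _, _ => good_atom _ _ a
    | _, _, _, .not h, hp, ha => good_not (base_good h hp ha)
    | _, _, _, .and h h', hp, ha => good_and (base_good h hp.1 ha.1) (base_good h' hp.2 ha.2)
    | _, _, _, .or h h', hp, ha => good_or (base_good h hp.1 ha.1) (base_good h' hp.2 ha.2)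
    | _, _, _, .dia k h, hp, ha => good_dia k (base_good h hp ha)
    | _, _, _, .box k h, hp, ha => good_box k (base_good h hp ha)
    | _, _, _, .var hX, _, _ => good_var hX
    | _, _, _, .fix h, hp, ha => (fix_good h hp ha).toGood _ _
  theorem fix_good : ∀ {Z O : Set ℕ} {θ : GMC AP}, IsFix Z O θ → θ.boundPos → θ.AltFree →
      FixGood Z O θ
    | _, _, _, .mu h, hp, ha => (fix_good h hp.1 ha.1).mu hp.2 ha.2
    | _, _, _, .nu h, hp, ha => (fix_good h hp.1 ha.1).nu hp.2 ha.2
    | _, _, _, .base h, hp, ha =>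
      ⟨(base_good h hp ha).fr, Or.inl fun b => shape_base b _ _ _ (base_good h hp ha)⟩
end

theorem FixGood.dfn {θ : GMC AP} (h : FixGood ∅ ∅ θ) (x : ℕ) :
    Dfn {x} ∅ (fun K V1 _ => V1 x ∈ θ.denot K (fun _ => ∅)) := by
  rcases h.sh with h | h | h
  · exact shape_closed true θ (h true) x
  · exact shape_closed false θ h.1 x
  · exact shape_closed true θ h.1 x

theorem final {θ : GMC AP} (h : FixGood ∅ ∅ θ) :
    Dfn ∅ ∅ (fun K _ _ => GKSat K θ) := by
  have h1 := (h.dfn 0).weaken (G1 := insert 0 ∅) (G2 := ∅) (by simp) subset_rfl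
  have h2 := dfn_le (AP := AP) (F1 := insert 1 (insert 0 ∅)) (F2 := ∅) 0 1 (by simp) (by simp)
  refine (Dfn.exFO 0 (h1.and (Dfn.allFO 1 h2))).congr ?_
  intro K _ V1 V2
  have hr := (rooted_iff _ _).1 K.rooted
  simp only [Function.update_self, ne_eq, zero_ne_one, not_false_eq_true,
    Function.update_of_ne, GKSat]
  constructor
  · rintro ⟨τ, hτ, a, b⟩
    have := (b K.root hr.1).2.2
    have e : τ = K.root := this.eq_of_length_le (hr.2.1 τ hτ).length_le
    rwa [← e]
  · intro a
    exact ⟨K.root, hr.1, a, fun τ hτ => ⟨hr.1, hτ, hr.2.1 τ hτ⟩⟩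

end OS

/-- OSAFGμC ≤ WMTL over finitely-branching trees: every
alternation-free OSGμC sentence has a WMTL sentence satisfied by exactly the
same finitely-branching Kripke trees. -/
theorem stmt18 (AP : Type) [Fintype AP] :
    ∀ θ : GMC AP, IsFix ∅ ∅ θ → θ.AllPos → θ.AltFree →
      ∃ φ : MSOL AP, φ.IsSentence ∧
        ∀ K : KripkeTree AP, FinBranching K.T →
          (GKSat K θ ↔ (WMTL AP).KSat K φ) := by
  intro θ hf hp ha
  obtain ⟨φ, h1, h2, h3⟩ := OS.final (OS.fix_good hf hp.1 ha)
  refine ⟨φ, ⟨Set.subset_empty_iff.1 h1, Set.subset_empty_iff.1 h2⟩, ?_⟩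
  intro K hK
  constructor
  · intro h
    exact ⟨fun _ => [], fun _ => ∅, (h3 K hK _ _).2 h⟩
  · rintro ⟨V1, V2, h⟩
    exact (h3 K hK V1 V2).1 h
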